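/- arXiv:2507.02082 — 8 statements merged into one kernel-verified Lean document; each statement's English description precedes it below -/
import Mathlib

section
/- Every cyclic adjusted skeletal 2-term L∞-algebra is Abelian. Concretely: under the assumptions in the context, the antisymmetric bilinear product μ₂ : L₀ × L₀ → L₀ vanishes identically and the alternating trilinear product μ₃ : L₀ × L₀ × L₀ → L₋₁ vanishes identically (so that, together with the vanishing of the mixed product ρ, all higher products of the 2-term L∞-algebra are trivial). -/
/-- Every cyclic adjusted skeletal 2-term L∞-algebra is Abelian: under the
cyclicity and adjustment conditions, the products `μ₂` and `μ₃` vanish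
identically. -/
theorem cyclic_adjusted_skeletal_two_term_abelian
    (L₀ Lm1 : Type*)
    [AddCommGroup L₀] [Module ℝ L₀] [FiniteDimensional ℝ L₀]
    [AddCommGroup Lm1] [Module ℝ Lm1] [FiniteDimensional ℝ Lm1]
    (pair : L₀ →ₗ[ℝ] Lm1 →ₗ[ℝ] ℝ)
    (hnondeg₁ : ∀ X : L₀, (∀ Y : Lm1, pair X Y = 0) → X = 0)
    (hnondeg₂ : ∀ Y : Lm1, (∀ X : L₀, pair X Y = 0) → Y = 0)
    (μ₂ : L₀ →ₗ[ℝ] L₀ →ₗ[ℝ] L₀)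
    (hμ₂anti : ∀ X₁ X₂ : L₀, μ₂ X₁ X₂ = - μ₂ X₂ X₁)
    (ρ : L₀ →ₗ[ℝ] Lm1 →ₗ[ℝ] Lm1)
    (μ₃ : L₀ →ₗ[ℝ] L₀ →ₗ[ℝ] L₀ →ₗ[ℝ] Lm1)
    (hμ₃alt : ∀ X₁ X₂ X₃ : L₀,
      μ₃ X₁ X₂ X₃ = - μ₃ X₂ X₁ X₃ ∧ μ₃ X₁ X₂ X₃ = - μ₃ X₁ X₃ X₂)
    (κ : L₀ →ₗ[ℝ] L₀ →ₗ[ℝ] Lm1)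
    (hcyc : ∀ (X₁ X₂ : L₀) (Y : Lm1), pair X₁ (ρ X₂ Y) = pair (μ₂ X₁ X₂) Y)
    (hadj₁ : ∀ (X : L₀) (Y : Lm1), ρ X Y = 0)
    (hadj₂ : ∀ X₁ X₂ X₃ : L₀,
      κ (μ₂ X₁ X₂) X₃ =
        κ X₁ (μ₂ X₂ X₃) - κ X₂ (μ₂ X₁ X₃)
          + ρ X₁ (κ X₂ X₃) - ρ X₂ (κ X₁ X₃) + μ₃ X₁ X₂ X₃) :
    (∀ X₁ X₂ : L₀, μ₂ X₁ X₂ = 0) ∧ (∀ X₁ X₂ X₃ : L₀, μ₃ X₁ X₂ X₃ = 0) := by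
  have hμ₂ : ∀ X₁ X₂ : L₀, μ₂ X₁ X₂ = 0 := fun X₁ X₂ =>
    hnondeg₁ _ fun Y => by rw [← hcyc, hadj₁, map_zero]
  refine ⟨hμ₂, fun X₁ X₂ X₃ => ?_⟩
  simpa [hμ₂, hadj₁] using (hadj₂ X₁ X₂ X₃).symm
end

section
/- In the cotangent construction associated with a crossed module of Lie algebras, the map t̂ : ĥ → ĝ defined by t̂(Y,X*) := (t(Y), t*(X*)) is a Lie algebra homomorphism from ĥ := 𝔥 ⊕ 𝔤* with bracket [(Y₁,X₁*),(Y₂,X₂*)] := ([Y₁,Y₂], ad*_{t(Y₁)} X₂* − ad*_{t(Y₂)} X₁*) to ĝ := 𝔤 ⊕ 𝔥* with bracket [(X₁,Y₁*),(X₂,Y₂*)] := ([X₁,X₂], X₁ ▷* Y₂* − X₂ ▷* Y₁*). -/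
/-- The map t̂(Y,X*) = (t Y, t* X*) is a Lie algebra homomorphism from
ĥ = 𝔥 ⊕ 𝔤* to ĝ = 𝔤 ⊕ 𝔥* in the cotangent construction. -/
theorem cotangent_tHat_is_lie_hom
    (𝔤 𝔥 : Type*) [LieRing 𝔤] [LieAlgebra ℝ 𝔤] [LieRing 𝔥] [LieAlgebra ℝ 𝔥]
    [FiniteDimensional ℝ 𝔤] [FiniteDimensional ℝ 𝔥]
    (t : 𝔥 →ₗ[ℝ] 𝔤) (ht : ∀ Y₁ Y₂ : 𝔥, t ⁅Y₁, Y₂⁆ = ⁅t Y₁, t Y₂⁆)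
    (act : 𝔤 →ₗ[ℝ] 𝔥 →ₗ[ℝ] 𝔥)
    (haction : ∀ (X₁ X₂ : 𝔤) (Y : 𝔥),
      act ⁅X₁, X₂⁆ Y = act X₁ (act X₂ Y) - act X₂ (act X₁ Y))
    (hderivation : ∀ (X : 𝔤) (Y₁ Y₂ : 𝔥),
      act X ⁅Y₁, Y₂⁆ = ⁅act X Y₁, Y₂⁆ + ⁅Y₁, act X Y₂⁆)
    (hequivariance : ∀ (X : 𝔤) (Y : 𝔥), t (act X Y) = ⁅X, t Y⁆)
    (hpeiffer : ∀ Y₁ Y₂ : 𝔥, act (t Y₁) Y₂ = ⁅Y₁, Y₂⁆)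
    (coad : 𝔤 → Module.Dual ℝ 𝔤 → Module.Dual ℝ 𝔤)
    (hcoad : ∀ (X : 𝔤) (Xs : Module.Dual ℝ 𝔤) (X' : 𝔤),
      coad X Xs X' = -(Xs ⁅X, X'⁆))
    (actD : 𝔤 → Module.Dual ℝ 𝔥 → Module.Dual ℝ 𝔥)
    (hactD : ∀ (X : 𝔤) (Ys : Module.Dual ℝ 𝔥) (Y : 𝔥),
      actD X Ys Y = -(Ys (act X Y)))
    (tD : Module.Dual ℝ 𝔤 → Module.Dual ℝ 𝔥)
    (htD : ∀ (Xs : Module.Dual ℝ 𝔤) (Y : 𝔥), tD Xs Y = Xs (t Y))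
    (braH : 𝔥 × Module.Dual ℝ 𝔤 → 𝔥 × Module.Dual ℝ 𝔤 → 𝔥 × Module.Dual ℝ 𝔤)
    (hbraH : ∀ w₁ w₂ : 𝔥 × Module.Dual ℝ 𝔤,
      braH w₁ w₂ = (⁅w₁.1, w₂.1⁆, coad (t w₁.1) w₂.2 - coad (t w₂.1) w₁.2))
    (braG : 𝔤 × Module.Dual ℝ 𝔥 → 𝔤 × Module.Dual ℝ 𝔥 → 𝔤 × Module.Dual ℝ 𝔥)
    (hbraG : ∀ v₁ v₂ : 𝔤 × Module.Dual ℝ 𝔥,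
      braG v₁ v₂ = (⁅v₁.1, v₂.1⁆, actD v₁.1 v₂.2 - actD v₂.1 v₁.2))
    (tHat : 𝔥 × Module.Dual ℝ 𝔤 → 𝔤 × Module.Dual ℝ 𝔥)
    (htHat : ∀ w : 𝔥 × Module.Dual ℝ 𝔤, tHat w = (t w.1, tD w.2)) :
    (∀ w₁ w₂ : 𝔥 × Module.Dual ℝ 𝔤, tHat (w₁ + w₂) = tHat w₁ + tHat w₂) ∧
    (∀ (a : ℝ) (w : 𝔥 × Module.Dual ℝ 𝔤), tHat (a • w) = a • tHat w) ∧
    (∀ w₁ w₂ : 𝔥 × Module.Dual ℝ 𝔤, tHat (braH w₁ w₂) = braG (tHat w₁) (tHat w₂)) := by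
  refine ⟨fun w₁ w₂ => ?_, fun a w => ?_, fun w₁ w₂ => ?_⟩
  · rw [htHat, htHat, htHat]
    refine Prod.ext (map_add t _ _) (LinearMap.ext fun Y => ?_)
    simp [htD]
  · rw [htHat, htHat]
    refine Prod.ext (map_smul t _ _) (LinearMap.ext fun Y => ?_)
    simp [htD]
  · rw [htHat, htHat, htHat, hbraH, hbraG]
    refine Prod.ext (ht _ _) (LinearMap.ext fun Y => ?_)
    simp only [htD, LinearMap.sub_apply, hcoad, hactD, hequivariance]
end

section
/- In the cotangent construction associated with a crossed module of Lie algebras, the map ▷̂ defined by (X,Y*) ▷̂ (Y',X*) := (X ▷ Y', ad*_X X* − μ(Y',Y*)) is an action of the Lie algebra ĝ := 𝔤 ⊕ 𝔥* on the Lie algebra ĥ := 𝔥 ⊕ 𝔤* by derivations: for all v, v₁, v₂ ∈ ĝ and w, w₁, w₂ ∈ ĥ one has [v₁,v₂] ▷̂ w = v₁ ▷̂ (v₂ ▷̂ w) − v₂ ▷̂ (v₁ ▷̂ w) and v ▷̂ [w₁,w₂] = [v ▷̂ w₁, w₂] + [w₁, v ▷̂ w₂]. -/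
/-- The map ▷̂ is an action of ĝ = 𝔤 ⊕ 𝔥* on ĥ = 𝔥 ⊕ 𝔤* by derivations in
the cotangent construction of a crossed module of Lie algebras. -/
theorem cotangent_actHat_is_action_by_derivations
    (𝔤 𝔥 : Type*) [LieRing 𝔤] [LieAlgebra ℝ 𝔤] [LieRing 𝔥] [LieAlgebra ℝ 𝔥]
    [FiniteDimensional ℝ 𝔤] [FiniteDimensional ℝ 𝔥]
    (t : 𝔥 →ₗ[ℝ] 𝔤) (ht : ∀ Y₁ Y₂ : 𝔥, t ⁅Y₁, Y₂⁆ = ⁅t Y₁, t Y₂⁆)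
    (act : 𝔤 →ₗ[ℝ] 𝔥 →ₗ[ℝ] 𝔥)
    (haction : ∀ (X₁ X₂ : 𝔤) (Y : 𝔥),
      act ⁅X₁, X₂⁆ Y = act X₁ (act X₂ Y) - act X₂ (act X₁ Y))
    (hderivation : ∀ (X : 𝔤) (Y₁ Y₂ : 𝔥),
      act X ⁅Y₁, Y₂⁆ = ⁅act X Y₁, Y₂⁆ + ⁅Y₁, act X Y₂⁆)
    (hequivariance : ∀ (X : 𝔤) (Y : 𝔥), t (act X Y) = ⁅X, t Y⁆)
    (hpeiffer : ∀ Y₁ Y₂ : 𝔥, act (t Y₁) Y₂ = ⁅Y₁, Y₂⁆)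
    (coad : 𝔤 → Module.Dual ℝ 𝔤 → Module.Dual ℝ 𝔤)
    (hcoad : ∀ (X : 𝔤) (Xs : Module.Dual ℝ 𝔤) (X' : 𝔤),
      coad X Xs X' = -(Xs ⁅X, X'⁆))
    (actD : 𝔤 → Module.Dual ℝ 𝔥 → Module.Dual ℝ 𝔥)
    (hactD : ∀ (X : 𝔤) (Ys : Module.Dual ℝ 𝔥) (Y : 𝔥),
      actD X Ys Y = -(Ys (act X Y)))
    (tD : Module.Dual ℝ 𝔤 → Module.Dual ℝ 𝔥)
    (htD : ∀ (Xs : Module.Dual ℝ 𝔤) (Y : 𝔥), tD Xs Y = Xs (t Y))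
    (μmap : 𝔥 → Module.Dual ℝ 𝔥 → Module.Dual ℝ 𝔤)
    (hμmap : ∀ (Y : 𝔥) (Ys : Module.Dual ℝ 𝔥) (X : 𝔤),
      μmap Y Ys X = Ys (act X Y))
    (braH : 𝔥 × Module.Dual ℝ 𝔤 → 𝔥 × Module.Dual ℝ 𝔤 → 𝔥 × Module.Dual ℝ 𝔤)
    (hbraH : ∀ w₁ w₂ : 𝔥 × Module.Dual ℝ 𝔤,
      braH w₁ w₂ = (⁅w₁.1, w₂.1⁆, coad (t w₁.1) w₂.2 - coad (t w₂.1) w₁.2))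
    (braG : 𝔤 × Module.Dual ℝ 𝔥 → 𝔤 × Module.Dual ℝ 𝔥 → 𝔤 × Module.Dual ℝ 𝔥)
    (hbraG : ∀ v₁ v₂ : 𝔤 × Module.Dual ℝ 𝔥,
      braG v₁ v₂ = (⁅v₁.1, v₂.1⁆, actD v₁.1 v₂.2 - actD v₂.1 v₁.2))
    (tHat : 𝔥 × Module.Dual ℝ 𝔤 → 𝔤 × Module.Dual ℝ 𝔥)
    (htHat : ∀ w : 𝔥 × Module.Dual ℝ 𝔤, tHat w = (t w.1, tD w.2))
    (actHat : 𝔤 × Module.Dual ℝ 𝔥 → 𝔥 × Module.Dual ℝ 𝔤 → 𝔥 × Module.Dual ℝ 𝔤)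
    (hactHat : ∀ (v : 𝔤 × Module.Dual ℝ 𝔥) (w : 𝔥 × Module.Dual ℝ 𝔤),
      actHat v w = (act v.1 w.1, coad v.1 w.2 - μmap w.1 v.2)) :
    (∀ (v₁ v₂ : 𝔤 × Module.Dual ℝ 𝔥) (w : 𝔥 × Module.Dual ℝ 𝔤),
      actHat (braG v₁ v₂) w = actHat v₁ (actHat v₂ w) - actHat v₂ (actHat v₁ w)) ∧
    (∀ (v : 𝔤 × Module.Dual ℝ 𝔥) (w₁ w₂ : 𝔥 × Module.Dual ℝ 𝔤),
      actHat v (braH w₁ w₂) = braH (actHat v w₁) w₂ + braH w₁ (actHat v w₂)) := by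
  constructor
  · rintro ⟨X₁, Y₁⟩ ⟨X₂, Y₂⟩ ⟨Y, Xs⟩
    simp only [hactHat, hbraG, Prod.mk_sub_mk, Prod.mk.injEq]
    refine ⟨haction X₁ X₂ Y, ?_⟩
    ext Z
    simp only [LinearMap.sub_apply, hcoad, hμmap, hactD, haction, lie_lie, map_sub]
    ring
  · rintro ⟨X, Ys⟩ ⟨Y₁, X₁⟩ ⟨Y₂, X₂⟩
    simp only [hactHat, hbraH, Prod.mk_add_mk, Prod.mk.injEq]
    refine ⟨hderivation X Y₁ Y₂, ?_⟩
    ext Z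
    have lie_t_act (Y Y' : 𝔥) : act ⁅t Y, Z⁆ Y' = -⁅act Z Y, Y'⁆ := by
      rw [← lie_skew, ← hequivariance, map_neg, LinearMap.neg_apply, hpeiffer]
    simp only [LinearMap.sub_apply, LinearMap.add_apply, hcoad, hμmap, hequivariance,
      hderivation, lie_t_act, lie_lie, map_sub, map_add, map_neg]
    rw [← lie_skew Y₁ (act Z Y₂), map_neg]
    ring
end

section
/- The cotangent construction associated with a crossed module of Lie algebras satisfies the equivariance and Peiffer conditions: for all v ∈ ĝ := 𝔤 ⊕ 𝔥* and w, w₁, w₂ ∈ ĥ := 𝔥 ⊕ 𝔤* one has t̂(v ▷̂ w) = [v, t̂(w)] (bracket in ĝ) and t̂(w₁) ▷̂ w₂ = [w₁, w₂] (bracket in ĥ). -/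
/-- The cotangent construction satisfies the equivariance and Peiffer
conditions:  t̂(v ▷̂ w) = [v, t̂ w]  and  t̂(w₁) ▷̂ w₂ = [w₁, w₂]. -/
theorem cotangent_equivariance_and_peiffer
    (𝔤 𝔥 : Type*) [LieRing 𝔤] [LieAlgebra ℝ 𝔤] [LieRing 𝔥] [LieAlgebra ℝ 𝔥]
    [FiniteDimensional ℝ 𝔤] [FiniteDimensional ℝ 𝔥]
    (t : 𝔥 →ₗ[ℝ] 𝔤) (ht : ∀ Y₁ Y₂ : 𝔥, t ⁅Y₁, Y₂⁆ = ⁅t Y₁, t Y₂⁆)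
    (act : 𝔤 →ₗ[ℝ] 𝔥 →ₗ[ℝ] 𝔥)
    (haction : ∀ (X₁ X₂ : 𝔤) (Y : 𝔥),
      act ⁅X₁, X₂⁆ Y = act X₁ (act X₂ Y) - act X₂ (act X₁ Y))
    (hderivation : ∀ (X : 𝔤) (Y₁ Y₂ : 𝔥),
      act X ⁅Y₁, Y₂⁆ = ⁅act X Y₁, Y₂⁆ + ⁅Y₁, act X Y₂⁆)
    (hequivariance : ∀ (X : 𝔤) (Y : 𝔥), t (act X Y) = ⁅X, t Y⁆)
    (hpeiffer : ∀ Y₁ Y₂ : 𝔥, act (t Y₁) Y₂ = ⁅Y₁, Y₂⁆)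
    (coad : 𝔤 → Module.Dual ℝ 𝔤 → Module.Dual ℝ 𝔤)
    (hcoad : ∀ (X : 𝔤) (Xs : Module.Dual ℝ 𝔤) (X' : 𝔤),
      coad X Xs X' = -(Xs ⁅X, X'⁆))
    (actD : 𝔤 → Module.Dual ℝ 𝔥 → Module.Dual ℝ 𝔥)
    (hactD : ∀ (X : 𝔤) (Ys : Module.Dual ℝ 𝔥) (Y : 𝔥),
      actD X Ys Y = -(Ys (act X Y)))
    (tD : Module.Dual ℝ 𝔤 → Module.Dual ℝ 𝔥)
    (htD : ∀ (Xs : Module.Dual ℝ 𝔤) (Y : 𝔥), tD Xs Y = Xs (t Y))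
    (μmap : 𝔥 → Module.Dual ℝ 𝔥 → Module.Dual ℝ 𝔤)
    (hμmap : ∀ (Y : 𝔥) (Ys : Module.Dual ℝ 𝔥) (X : 𝔤),
      μmap Y Ys X = Ys (act X Y))
    (braH : 𝔥 × Module.Dual ℝ 𝔤 → 𝔥 × Module.Dual ℝ 𝔤 → 𝔥 × Module.Dual ℝ 𝔤)
    (hbraH : ∀ w₁ w₂ : 𝔥 × Module.Dual ℝ 𝔤,
      braH w₁ w₂ = (⁅w₁.1, w₂.1⁆, coad (t w₁.1) w₂.2 - coad (t w₂.1) w₁.2))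
    (braG : 𝔤 × Module.Dual ℝ 𝔥 → 𝔤 × Module.Dual ℝ 𝔥 → 𝔤 × Module.Dual ℝ 𝔥)
    (hbraG : ∀ v₁ v₂ : 𝔤 × Module.Dual ℝ 𝔥,
      braG v₁ v₂ = (⁅v₁.1, v₂.1⁆, actD v₁.1 v₂.2 - actD v₂.1 v₁.2))
    (tHat : 𝔥 × Module.Dual ℝ 𝔤 → 𝔤 × Module.Dual ℝ 𝔥)
    (htHat : ∀ w : 𝔥 × Module.Dual ℝ 𝔤, tHat w = (t w.1, tD w.2))
    (actHat : 𝔤 × Module.Dual ℝ 𝔥 → 𝔥 × Module.Dual ℝ 𝔤 → 𝔥 × Module.Dual ℝ 𝔤)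
    (hactHat : ∀ (v : 𝔤 × Module.Dual ℝ 𝔥) (w : 𝔥 × Module.Dual ℝ 𝔤),
      actHat v w = (act v.1 w.1, coad v.1 w.2 - μmap w.1 v.2)) :
    (∀ (v : 𝔤 × Module.Dual ℝ 𝔥) (w : 𝔥 × Module.Dual ℝ 𝔤), tHat (actHat v w) = braG v (tHat w)) ∧
    (∀ w₁ w₂ : 𝔥 × Module.Dual ℝ 𝔤, actHat (tHat w₁) w₂ = braH w₁ w₂) := by
  refine ⟨fun v w ↦ ?_, fun w₁ w₂ ↦ ?_⟩
  · rw [hactHat, htHat, htHat, hbraG]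
    refine Prod.ext (hequivariance _ _) (LinearMap.ext fun Y ↦ ?_)
    simp only [htD, LinearMap.sub_apply, hcoad, hμmap, hactD, hequivariance, hpeiffer]
    rw [← lie_skew w.1 Y, map_neg, neg_neg, sub_eq_add_neg]
  · rw [hactHat, htHat, hbraH]
    refine Prod.ext (hpeiffer _ _) (LinearMap.ext fun X ↦ ?_)
    simp only [htD, LinearMap.sub_apply, hcoad, hμmap, hequivariance]
    rw [← lie_skew X (t w₂.1), map_neg]
end

section
/- The canonical pairing of the cotangent construction associated with a crossed module of Lie algebras is cyclic: defining ⟨(X,Y*),(Y,X*)⟩ := ½(X*(X) + Y*(Y)) for (X,Y*) ∈ ĝ := 𝔤 ⊕ 𝔥* and (Y,X*) ∈ ĥ := 𝔥 ⊕ 𝔤*, one has ⟨[v₁,v₂], w⟩ = ⟨v₁, v₂ ▷̂ w⟩ for all v₁,v₂ ∈ ĝ and w ∈ ĥ, and ⟨t̂(w₁), w₂⟩ = ⟨t̂(w₂), w₁⟩ for all w₁,w₂ ∈ ĥ. -/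
/-- The canonical pairing of the cotangent construction is cyclic:
⟨[v₁,v₂], w⟩ = ⟨v₁, v₂ ▷̂ w⟩ and ⟨t̂ w₁, w₂⟩ = ⟨t̂ w₂, w₁⟩. -/
theorem cotangent_pairing_is_cyclic
    (𝔤 𝔥 : Type*) [LieRing 𝔤] [LieAlgebra ℝ 𝔤] [LieRing 𝔥] [LieAlgebra ℝ 𝔥]
    [FiniteDimensional ℝ 𝔤] [FiniteDimensional ℝ 𝔥]
    (t : 𝔥 →ₗ[ℝ] 𝔤) (ht : ∀ Y₁ Y₂ : 𝔥, t ⁅Y₁, Y₂⁆ = ⁅t Y₁, t Y₂⁆)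
    (act : 𝔤 →ₗ[ℝ] 𝔥 →ₗ[ℝ] 𝔥)
    (haction : ∀ (X₁ X₂ : 𝔤) (Y : 𝔥),
      act ⁅X₁, X₂⁆ Y = act X₁ (act X₂ Y) - act X₂ (act X₁ Y))
    (hderivation : ∀ (X : 𝔤) (Y₁ Y₂ : 𝔥),
      act X ⁅Y₁, Y₂⁆ = ⁅act X Y₁, Y₂⁆ + ⁅Y₁, act X Y₂⁆)
    (hequivariance : ∀ (X : 𝔤) (Y : 𝔥), t (act X Y) = ⁅X, t Y⁆)
    (hpeiffer : ∀ Y₁ Y₂ : 𝔥, act (t Y₁) Y₂ = ⁅Y₁, Y₂⁆)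
    (coad : 𝔤 → Module.Dual ℝ 𝔤 → Module.Dual ℝ 𝔤)
    (hcoad : ∀ (X : 𝔤) (Xs : Module.Dual ℝ 𝔤) (X' : 𝔤),
      coad X Xs X' = -(Xs ⁅X, X'⁆))
    (actD : 𝔤 → Module.Dual ℝ 𝔥 → Module.Dual ℝ 𝔥)
    (hactD : ∀ (X : 𝔤) (Ys : Module.Dual ℝ 𝔥) (Y : 𝔥),
      actD X Ys Y = -(Ys (act X Y)))
    (tD : Module.Dual ℝ 𝔤 → Module.Dual ℝ 𝔥)
    (htD : ∀ (Xs : Module.Dual ℝ 𝔤) (Y : 𝔥), tD Xs Y = Xs (t Y))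
    (μmap : 𝔥 → Module.Dual ℝ 𝔥 → Module.Dual ℝ 𝔤)
    (hμmap : ∀ (Y : 𝔥) (Ys : Module.Dual ℝ 𝔥) (X : 𝔤),
      μmap Y Ys X = Ys (act X Y))
    (braH : 𝔥 × Module.Dual ℝ 𝔤 → 𝔥 × Module.Dual ℝ 𝔤 → 𝔥 × Module.Dual ℝ 𝔤)
    (hbraH : ∀ w₁ w₂ : 𝔥 × Module.Dual ℝ 𝔤,
      braH w₁ w₂ = (⁅w₁.1, w₂.1⁆, coad (t w₁.1) w₂.2 - coad (t w₂.1) w₁.2))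
    (braG : 𝔤 × Module.Dual ℝ 𝔥 → 𝔤 × Module.Dual ℝ 𝔥 → 𝔤 × Module.Dual ℝ 𝔥)
    (hbraG : ∀ v₁ v₂ : 𝔤 × Module.Dual ℝ 𝔥,
      braG v₁ v₂ = (⁅v₁.1, v₂.1⁆, actD v₁.1 v₂.2 - actD v₂.1 v₁.2))
    (tHat : 𝔥 × Module.Dual ℝ 𝔤 → 𝔤 × Module.Dual ℝ 𝔥)
    (htHat : ∀ w : 𝔥 × Module.Dual ℝ 𝔤, tHat w = (t w.1, tD w.2))
    (actHat : 𝔤 × Module.Dual ℝ 𝔥 → 𝔥 × Module.Dual ℝ 𝔤 → 𝔥 × Module.Dual ℝ 𝔤)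
    (hactHat : ∀ (v : 𝔤 × Module.Dual ℝ 𝔥) (w : 𝔥 × Module.Dual ℝ 𝔤),
      actHat v w = (act v.1 w.1, coad v.1 w.2 - μmap w.1 v.2))
    (pair : (𝔤 × Module.Dual ℝ 𝔥) → (𝔥 × Module.Dual ℝ 𝔤) → ℝ)
    (hpair : ∀ (v : 𝔤 × Module.Dual ℝ 𝔥) (w : 𝔥 × Module.Dual ℝ 𝔤),
      pair v w = (1 / 2 : ℝ) * (w.2 v.1 + v.2 w.1)) :
    (∀ (v₁ v₂ : 𝔤 × Module.Dual ℝ 𝔥) (w : 𝔥 × Module.Dual ℝ 𝔤), pair (braG v₁ v₂) w = pair v₁ (actHat v₂ w)) ∧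
    (∀ w₁ w₂ : 𝔥 × Module.Dual ℝ 𝔤, pair (tHat w₁) w₂ = pair (tHat w₂) w₁) := by
  refine ⟨fun v₁ v₂ w => ?_, fun w₁ w₂ => ?_⟩
  · have hskew : w.2 ⁅v₁.1, v₂.1⁆ = -(w.2 ⁅v₂.1, v₁.1⁆) := by
      rw [← lie_skew, map_neg]
    simp only [hpair, hbraG, hactHat, LinearMap.sub_apply, hactD, hcoad, hμmap, hskew]
    ring
  · simp only [hpair, htHat, htD]
    ring
end

section
/- The map ν₂ behaves like a left action of G on 𝔥 compatible with t: for all g, g₁, g₂ ∈ G, Y ∈ 𝔥 and X ∈ 𝔤 one has ν₂(g₁, ν₂(g₂, Y)) = ν₂(g₁g₂, Y) and t(ν₂(g,Y)) = ν̃₂(g, t(Y)). -/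
/-- The map ν₂(g,Y) = g·Y − κ(g,t(Y)) behaves like a left action of G on 𝔥
compatible with t: ν₂(g₁,ν₂(g₂,Y)) = ν₂(g₁g₂,Y) and t(ν₂(g,Y)) = ν̃₂(g,t(Y)). -/
theorem nu_two_left_action_compatible
    (G : Type*) [Group G] (𝔤 𝔥 : Type*)
    [AddCommGroup 𝔤] [Module ℝ 𝔤] [FiniteDimensional ℝ 𝔤]
    [AddCommGroup 𝔥] [Module ℝ 𝔥] [FiniteDimensional ℝ 𝔥]
    (t : 𝔥 →ₗ[ℝ] 𝔤)
    (ρg : G →* Module.End ℝ 𝔤) (ρh : G →* Module.End ℝ 𝔥)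
    (ht : ∀ (g : G) (Y : 𝔥), t (ρh g Y) = ρg g (t Y))
    (κ : G → 𝔤 →ₗ[ℝ] 𝔥)
    (hκ : ∀ (g₁ g₂ : G) (X : 𝔤),
      κ (g₂ * g₁) X = ρh g₂ (κ g₁ X) + κ g₂ (ρg g₁ X - t (κ g₁ X)))
    (ν₂ : G → 𝔥 → 𝔥) (hν₂ : ∀ (g : G) (Y : 𝔥), ν₂ g Y = ρh g Y - κ g (t Y))
    (ν₂t : G → 𝔤 → 𝔤) (hν₂t : ∀ (g : G) (X : 𝔤), ν₂t g X = ρg g X - t (κ g X)) :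
    (∀ (g₁ g₂ : G) (Y : 𝔥), ν₂ g₁ (ν₂ g₂ Y) = ν₂ (g₁ * g₂) Y) ∧
    (∀ (g : G) (Y : 𝔥), t (ν₂ g Y) = ν₂t g (t Y)) := by
  refine ⟨fun g₁ g₂ Y => ?_, fun g Y => ?_⟩
  · simp only [hν₂, hκ, map_sub, map_mul, Module.End.mul_apply, ht]
    abel
  · rw [hν₂, hν₂t, map_sub, ht]
end

section
/- The dual map ν₂* satisfies the composition identity ν₂*(g₁g₂, Y*) = ν₂*(g₁, g₂·Y*) − t*(ν̃₂*(g₁, κ*(g₂, Y*))) for all g₁, g₂ ∈ G and Y* ∈ 𝔥*. -/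
/-- The dual map ν₂* satisfies
ν₂*(g₁g₂, Y*) = ν₂*(g₁, g₂·Y*) − t*(ν̃₂*(g₁, κ*(g₂, Y*))). -/
theorem dual_nu_two_composition
    (G : Type*) [Group G] (𝔤 𝔥 : Type*)
    [AddCommGroup 𝔤] [Module ℝ 𝔤] [FiniteDimensional ℝ 𝔤]
    [AddCommGroup 𝔥] [Module ℝ 𝔥] [FiniteDimensional ℝ 𝔥]
    (t : 𝔥 →ₗ[ℝ] 𝔤)
    (ρg : G →* Module.End ℝ 𝔤) (ρh : G →* Module.End ℝ 𝔥)
    (ht : ∀ (g : G) (Y : 𝔥), t (ρh g Y) = ρg g (t Y))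
    (κ : G → 𝔤 →ₗ[ℝ] 𝔥)
    (hκ : ∀ (g₁ g₂ : G) (X : 𝔤),
      κ (g₂ * g₁) X = ρh g₂ (κ g₁ X) + κ g₂ (ρg g₁ X - t (κ g₁ X)))
    (ν₂ : G → 𝔥 → 𝔥) (hν₂ : ∀ (g : G) (Y : 𝔥), ν₂ g Y = ρh g Y - κ g (t Y))
    (ν₂t : G → 𝔤 → 𝔤) (hν₂t : ∀ (g : G) (X : 𝔤), ν₂t g X = ρg g X - t (κ g X))
    (κD : G → Module.Dual ℝ 𝔥 → Module.Dual ℝ 𝔤)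
    (hκD : ∀ (g : G) (Ys : Module.Dual ℝ 𝔥) (X : 𝔤), κD g Ys X = Ys (κ g⁻¹ X))
    (ν₂D : G → Module.Dual ℝ 𝔥 → Module.Dual ℝ 𝔥)
    (hν₂D : ∀ (g : G) (Ys : Module.Dual ℝ 𝔥) (Y : 𝔥), ν₂D g Ys Y = Ys (ν₂ g⁻¹ Y))
    (ν₂tD : G → Module.Dual ℝ 𝔤 → Module.Dual ℝ 𝔤)
    (hν₂tD : ∀ (g : G) (Xs : Module.Dual ℝ 𝔤) (X : 𝔤), ν₂tD g Xs X = Xs (ν₂t g⁻¹ X))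
    (ρhD : G → Module.Dual ℝ 𝔥 → Module.Dual ℝ 𝔥)
    (hρhD : ∀ (g : G) (Ys : Module.Dual ℝ 𝔥) (Y : 𝔥), ρhD g Ys Y = Ys (ρh g⁻¹ Y))
    (ρgD : G → Module.Dual ℝ 𝔤 → Module.Dual ℝ 𝔤)
    (hρgD : ∀ (g : G) (Xs : Module.Dual ℝ 𝔤) (X : 𝔤), ρgD g Xs X = Xs (ρg g⁻¹ X))
    (tD : Module.Dual ℝ 𝔤 → Module.Dual ℝ 𝔥)
    (htD : ∀ (Xs : Module.Dual ℝ 𝔤) (Y : 𝔥), tD Xs Y = Xs (t Y)) :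
    ∀ (g₁ g₂ : G) (Ys : Module.Dual ℝ 𝔥),
      ν₂D (g₁ * g₂) Ys = ν₂D g₁ (ρhD g₂ Ys) - tD (ν₂tD g₁ (κD g₂ Ys)) := by
  intro g₁ g₂ Ys
  ext Y
  simp only [LinearMap.sub_apply, hν₂D, hρhD, htD, hν₂tD, hκD, hν₂, hν₂t, mul_inv_rev, hκ,
    map_mul, Module.End.mul_apply, map_sub, map_add]
  ring
end

section
/- The dual map ν̃₂* satisfies the composition identity ν̃₂*(g₁g₂, X*) = g₁·ν̃₂*(g₂, X*) − κ*(g₁, ν₂*(g₂, t*(X*))) for all g₁, g₂ ∈ G and X* ∈ 𝔤*. -/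
/-- The dual map ν̃₂* satisfies
ν̃₂*(g₁g₂, X*) = g₁·ν̃₂*(g₂, X*) − κ*(g₁, ν₂*(g₂, t*(X*))). -/
theorem dual_nu_tilde_two_composition
    (G : Type*) [Group G] (𝔤 𝔥 : Type*)
    [AddCommGroup 𝔤] [Module ℝ 𝔤] [FiniteDimensional ℝ 𝔤]
    [AddCommGroup 𝔥] [Module ℝ 𝔥] [FiniteDimensional ℝ 𝔥]
    (t : 𝔥 →ₗ[ℝ] 𝔤)
    (ρg : G →* Module.End ℝ 𝔤) (ρh : G →* Module.End ℝ 𝔥)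
    (ht : ∀ (g : G) (Y : 𝔥), t (ρh g Y) = ρg g (t Y))
    (κ : G → 𝔤 →ₗ[ℝ] 𝔥)
    (hκ : ∀ (g₁ g₂ : G) (X : 𝔤),
      κ (g₂ * g₁) X = ρh g₂ (κ g₁ X) + κ g₂ (ρg g₁ X - t (κ g₁ X)))
    (ν₂ : G → 𝔥 → 𝔥) (hν₂ : ∀ (g : G) (Y : 𝔥), ν₂ g Y = ρh g Y - κ g (t Y))
    (ν₂t : G → 𝔤 → 𝔤) (hν₂t : ∀ (g : G) (X : 𝔤), ν₂t g X = ρg g X - t (κ g X))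
    (κD : G → Module.Dual ℝ 𝔥 → Module.Dual ℝ 𝔤)
    (hκD : ∀ (g : G) (Ys : Module.Dual ℝ 𝔥) (X : 𝔤), κD g Ys X = Ys (κ g⁻¹ X))
    (ν₂D : G → Module.Dual ℝ 𝔥 → Module.Dual ℝ 𝔥)
    (hν₂D : ∀ (g : G) (Ys : Module.Dual ℝ 𝔥) (Y : 𝔥), ν₂D g Ys Y = Ys (ν₂ g⁻¹ Y))
    (ν₂tD : G → Module.Dual ℝ 𝔤 → Module.Dual ℝ 𝔤)
    (hν₂tD : ∀ (g : G) (Xs : Module.Dual ℝ 𝔤) (X : 𝔤), ν₂tD g Xs X = Xs (ν₂t g⁻¹ X))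
    (ρhD : G → Module.Dual ℝ 𝔥 → Module.Dual ℝ 𝔥)
    (hρhD : ∀ (g : G) (Ys : Module.Dual ℝ 𝔥) (Y : 𝔥), ρhD g Ys Y = Ys (ρh g⁻¹ Y))
    (ρgD : G → Module.Dual ℝ 𝔤 → Module.Dual ℝ 𝔤)
    (hρgD : ∀ (g : G) (Xs : Module.Dual ℝ 𝔤) (X : 𝔤), ρgD g Xs X = Xs (ρg g⁻¹ X))
    (tD : Module.Dual ℝ 𝔤 → Module.Dual ℝ 𝔥)
    (htD : ∀ (Xs : Module.Dual ℝ 𝔤) (Y : 𝔥), tD Xs Y = Xs (t Y)) :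
    ∀ (g₁ g₂ : G) (Xs : Module.Dual ℝ 𝔤),
      ν₂tD (g₁ * g₂) Xs = ρgD g₁ (ν₂tD g₂ Xs) - κD g₁ (ν₂D g₂ (tD Xs)) := by
  intro g₁ g₂ Xs
  ext X
  simp only [LinearMap.sub_apply, hν₂tD, hρgD, hκD, hν₂D, htD, hν₂t, hν₂, mul_inv_rev, hκ,
    map_mul, Module.End.mul_apply, map_sub, map_add]
  abel
end
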